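/- arXiv:2410.19137 — 2 statements merged into one kernel-verified Lean document; each statement's English description precedes it below -/
import Mathlib

section
/- Let d ≥ 2 and p ∈ [d−1, d). There exists a nonnegative measurable function b on ℝ^d, belonging to L_p(ℝ^d), such that: (i) sup { ρ·(⨍_{B_ρ(x)} b^p dy)^{1/p} : 0 < ρ ≤ 1, x ∈ ℝ^d } < ∞ (equivalently, there is a constant N with ∫_B b^p dy ≤ N·ρ^{d−p} for every ball B of radius ρ ≤ 1); and (ii) for every q > p, ∫_{B_1(0)} b^q dy = ∞ (in particular b ∉ L_q(B_1(0)) for any q > p). -/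
open MeasureTheory ENNReal NNReal Metric Set Filter Topology

noncomputable section

/-- Euclidean space `ℝ^d`. -/
abbrev Spc (d : ℕ) : Type := EuclideanSpace ℝ (Fin d)

/-- Space-time `ℝ^{d+1} = ℝ × ℝ^d`, a point is `(t, x)`. -/
abbrev SpT (d : ℕ) : Type := ℝ × Spc d

/-- The parabolic cylinder `C_ρ(t₀,x₀) = [t₀, t₀+ρ²) × B_ρ(x₀)`. -/
def pCyl (d : ℕ) (ρ t₀ : ℝ) (x₀ : Spc d) : Set (SpT d) :=
  (Set.Ico t₀ (t₀ + ρ ^ 2)) ×ˢ (Metric.ball x₀ ρ)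

/-- The (unnormalized) norm `‖f‖_{L_{p,q}(A)}
    = (∫_ℝ (∫_{ℝ^d} |f(t,x)|^p 1_A(t,x) dx)^{q/p} dt)^{1/q}`. -/
def lpqNorm (d : ℕ) (p q : ℝ) (f : SpT d → ℝ) (A : Set (SpT d)) : ℝ≥0∞ :=
  (∫⁻ t : ℝ, (∫⁻ x : Spc d, A.indicator (fun z => ENNReal.ofReal |f z| ^ p) (t, x)) ^ (q / p)) ^ (1 / q)

/-- The normalized norm `⨍‖f‖_{L_{p,q}(C)}` over the cylinder `C_ρ(t₀,x₀)`:
    inner integral replaced by the average over the spatial ball, outer one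
    by the average over the time interval. -/
def avgLpq (d : ℕ) (p q ρ t₀ : ℝ) (x₀ : Spc d) (f : SpT d → ℝ) : ℝ≥0∞ :=
  ((∫⁻ t in Set.Ico t₀ (t₀ + ρ ^ 2),
      ((∫⁻ x in Metric.ball x₀ ρ, ENNReal.ofReal |f (t, x)| ^ p) / volume (Metric.ball x₀ ρ)) ^ (q / p))
      / ENNReal.ofReal (ρ ^ 2)) ^ (1 / q)

/-- The parabolic Morrey norm `‖f‖_{E_{p,q,β}}
    = sup { ρ^β ⨍‖f‖_{L_{p,q}(C)} : 0 < ρ ≤ 1, C ∈ ℂ_ρ }`. -/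
def morreyNorm (d : ℕ) (p q β : ℝ) (f : SpT d → ℝ) : ℝ≥0∞ :=
  ⨆ (ρ : ℝ) (_ : 0 < ρ) (_ : ρ ≤ 1) (t₀ : ℝ) (x₀ : Spc d),
    ENNReal.ofReal (ρ ^ β) * avgLpq d p q ρ t₀ x₀ f

/-- The homogeneous parabolic Morrey norm `‖f‖_{Ė_{p,q,β}}` (all radii `ρ > 0`). -/
def morreyNormH (d : ℕ) (p q β : ℝ) (f : SpT d → ℝ) : ℝ≥0∞ :=
  ⨆ (ρ : ℝ) (_ : 0 < ρ) (t₀ : ℝ) (x₀ : Spc d),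
    ENNReal.ofReal (ρ ^ β) * avgLpq d p q ρ t₀ x₀ f

/-- Membership `f ∈ E_{p,q,β}`. -/
def MemE (d : ℕ) (p q β : ℝ) (f : SpT d → ℝ) : Prop :=
  AEStronglyMeasurable f volume ∧ morreyNorm d p q β f ≠ ⊤

/-- Membership `f ∈ Ė_{p,q,β}` (homogeneous). -/
def MemEH (d : ℕ) (p q β : ℝ) (f : SpT d → ℝ) : Prop :=
  AEStronglyMeasurable f volume ∧ morreyNormH d p q β f ≠ ⊤

/-- The elliptic Morrey norm `‖f‖_{E_{p,β}(ℝ^d)}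
    = sup { ρ^β (⨍_{B_ρ(x)} |f|^p)^{1/p} : 0 < ρ ≤ 1, x ∈ ℝ^d }`. -/
def morreyNormE (d : ℕ) (p β : ℝ) (f : Spc d → ℝ) : ℝ≥0∞ :=
  ⨆ (ρ : ℝ) (_ : 0 < ρ) (_ : ρ ≤ 1) (x₀ : Spc d),
    ENNReal.ofReal (ρ ^ β) *
      ((∫⁻ y in Metric.ball x₀ ρ, ENNReal.ofReal |f y| ^ p) / volume (Metric.ball x₀ ρ)) ^ (1 / p)

/-- The homogeneous elliptic Morrey norm on `ℝ^d` (all radii `ρ > 0`). -/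
def morreyNormEH (d : ℕ) (p β : ℝ) (f : Spc d → ℝ) : ℝ≥0∞ :=
  ⨆ (ρ : ℝ) (_ : 0 < ρ) (x₀ : Spc d),
    ENNReal.ofReal (ρ ^ β) *
      ((∫⁻ y in Metric.ball x₀ ρ, ENNReal.ofReal |f y| ^ p) / volume (Metric.ball x₀ ρ)) ^ (1 / p)

/-- A mollifying kernel: nonnegative, smooth, compactly supported in
    `[-1,0) × B_1(0)`, with unit integral. -/
def IsMollifier (d : ℕ) (ζ : SpT d → ℝ) : Prop :=
  ContDiff ℝ (⊤ : ℕ∞) ζ ∧ (∀ z, 0 ≤ ζ z) ∧ (∫ z, ζ z) = 1 ∧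
    Function.support ζ ⊆ (Set.Ico (-1 : ℝ) 0) ×ˢ (Metric.ball (0 : Spc d) 1)

/-- The mollification `f^{(ε)} = f * ζ_ε`, where
    `ζ_ε(t,x) = ε^{-d-2} ζ(t/ε², x/ε)`. -/
def mollify (d : ℕ) (ζ : SpT d → ℝ) (ε : ℝ) (f : SpT d → ℝ) (z : SpT d) : ℝ :=
  ∫ w : SpT d, (ε ^ (-(d : ℝ) - 2) * ζ (w.1 / ε ^ 2, ε⁻¹ • w.2)) * f (z.1 - w.1, z.2 - w.2)

/-- The time direction in space-time. -/
def dirT (d : ℕ) : SpT d := (1, 0)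

/-- The `i`-th spatial direction in space-time. -/
def dirS (d : ℕ) (i : Fin d) : SpT d := (0, EuclideanSpace.single i 1)

/-- `v` is the weak derivative of `u` in the direction `e`. -/
def IsWeakDeriv (d : ℕ) (u v : SpT d → ℝ) (e : SpT d) : Prop :=
  ∀ φ : SpT d → ℝ, ContDiff ℝ (⊤ : ℕ∞) φ → HasCompactSupport φ →
    ∫ z, u z * fderiv ℝ φ z e = - ∫ z, v z * φ z

/-- `v` is the second weak derivative of `u` in the directions `e₁, e₂`. -/
def IsWeakDeriv2 (d : ℕ) (u v : SpT d → ℝ) (e₁ e₂ : SpT d) : Prop :=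
  ∀ φ : SpT d → ℝ, ContDiff ℝ (⊤ : ℕ∞) φ → HasCompactSupport φ →
    ∫ z, u z * fderiv ℝ (fun w => fderiv ℝ φ w e₁) z e₂ = ∫ z, v z * φ z

/-- The magnitude `|Du|` of the spatial gradient. -/
def gradMag (d : ℕ) (Du : Fin d → SpT d → ℝ) (z : SpT d) : ℝ :=
  Real.sqrt (∑ i, (Du i z) ^ 2)

/-- The magnitude `|D²u|` of the spatial Hessian. -/
def hessMag (d : ℕ) (D2u : Fin d → Fin d → SpT d → ℝ) (z : SpT d) : ℝ :=
  Real.sqrt (∑ i, ∑ j, (D2u i j z) ^ 2)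

/-- `u ∈ E^{1,2}_{p,q,β}`, with weak spatial gradient `Du`, weak spatial Hessian
    `D2u`, and weak time derivative `ut`, all in `E_{p,q,β}`. -/
def Mem12 (d : ℕ) (p q β : ℝ) (u : SpT d → ℝ) (Du : Fin d → SpT d → ℝ)
    (D2u : Fin d → Fin d → SpT d → ℝ) (ut : SpT d → ℝ) : Prop :=
  MemE d p q β u ∧ (∀ i, IsWeakDeriv d u (Du i) (dirS d i)) ∧
    (∀ i j, IsWeakDeriv2 d u (D2u i j) (dirS d i) (dirS d j)) ∧
    IsWeakDeriv d u ut (dirT d) ∧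
    (∀ i, MemE d p q β (Du i)) ∧ (∀ i j, MemE d p q β (D2u i j)) ∧ MemE d p q β ut

/-- `u ∈ Ė^{1,2}_{p,q,β}` (homogeneous version). -/
def Mem12H (d : ℕ) (p q β : ℝ) (u : SpT d → ℝ) (Du : Fin d → SpT d → ℝ)
    (D2u : Fin d → Fin d → SpT d → ℝ) (ut : SpT d → ℝ) : Prop :=
  MemEH d p q β u ∧ (∀ i, IsWeakDeriv d u (Du i) (dirS d i)) ∧
    (∀ i j, IsWeakDeriv2 d u (D2u i j) (dirS d i) (dirS d j)) ∧
    IsWeakDeriv d u ut (dirT d) ∧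
    (∀ i, MemEH d p q β (Du i)) ∧ (∀ i j, MemEH d p q β (D2u i j)) ∧ MemEH d p q β ut

/-- The norm `‖u‖_{E^{1,2}_{p,q,β}} = ‖u‖ + ‖Du‖ + ‖D²u‖ + ‖∂ₜu‖`. -/
def norm12 (d : ℕ) (p q β : ℝ) (u : SpT d → ℝ) (Du : Fin d → SpT d → ℝ)
    (D2u : Fin d → Fin d → SpT d → ℝ) (ut : SpT d → ℝ) : ℝ≥0∞ :=
  morreyNorm d p q β u + morreyNorm d p q β (gradMag d Du)
    + morreyNorm d p q β (hessMag d D2u) + morreyNorm d p q β ut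

/-- Membership `f ∈ L_{p,q}(ℝ^{d+1})`. -/
def MemLpq (d : ℕ) (p q : ℝ) (f : SpT d → ℝ) : Prop :=
  AEStronglyMeasurable f volume ∧ lpqNorm d p q f Set.univ ≠ ⊤

/-- `u ∈ W^{1,2}_{p,q}(ℝ^{d+1})`: `u`, its weak spatial gradient `Du`,
    weak spatial Hessian `D2u` and weak time derivative `ut` are in `L_{p,q}`. -/
def MemW12 (d : ℕ) (p q : ℝ) (u : SpT d → ℝ) (Du : Fin d → SpT d → ℝ)
    (D2u : Fin d → Fin d → SpT d → ℝ) (ut : SpT d → ℝ) : Prop :=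
  MemLpq d p q u ∧ (∀ i, IsWeakDeriv d u (Du i) (dirS d i)) ∧
    (∀ i j, IsWeakDeriv2 d u (D2u i j) (dirS d i) (dirS d j)) ∧
    IsWeakDeriv d u ut (dirT d) ∧
    (∀ i, MemLpq d p q (Du i)) ∧ (∀ i j, MemLpq d p q (D2u i j)) ∧ MemLpq d p q ut

/-- Convergence `F ε → v` in `L_r(B)` as `ε ↓ 0`. -/
def TendstoLr (d : ℕ) (r : ℝ) (B : Set (Spc d)) (F : ℝ → Spc d → ℝ) (v : Spc d → ℝ) : Prop :=
  Tendsto (fun ε => (∫⁻ x in B, ENNReal.ofReal |F ε x - v x| ^ r) ^ (1 / r))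
    (𝓝[>] (0 : ℝ)) (𝓝 0)

/-- The open box with corners `l` and `u`. -/
def openBox {d : ℕ} (l u : Fin d → ℝ) : Set (Spc d) := {x | ∀ i, x i ∈ Ioo (l i) (u i)}

lemma measurableSet_openBox {d : ℕ} (l u : Fin d → ℝ) : MeasurableSet (openBox l u) := by
  have : openBox l u = ⋂ i, (fun x : Spc d => x i) ⁻¹' Ioo (l i) (u i) := by
    ext x; simp [openBox]
  rw [this]
  exact MeasurableSet.iInter fun i => (by fun_prop : Measurable fun x : Spc d => x i)
    measurableSet_Ioo

lemma volume_openBox {d : ℕ} (l u : Fin d → ℝ) :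
    volume (openBox l u) = ∏ i, ENNReal.ofReal (u i - l i) := by
  have h := (EuclideanSpace.volume_preserving_symm_measurableEquiv_toLp
    (Fin d)).measure_preimage_equiv (Set.pi univ fun i => Ioo (l i) (u i))
  rw [Real.volume_pi_Ioo] at h
  rw [← h]
  congr 1
  ext x
  simp [openBox]

/-- The box `(0, a) × (0, 1)^m` scaled by `1 / (m + 1)`, which makes it fit into the unit ball. -/
def slab (m : ℕ) (a : ℝ) : Set (Spc (m + 1)) :=
  openBox (fun _ => 0) (Fin.cons (a / (m + 1)) fun _ => 1 / (m + 1))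

lemma measurableSet_slab (m : ℕ) (a : ℝ) : MeasurableSet (slab m a) := measurableSet_openBox _ _

lemma volume_slab (m : ℕ) {a : ℝ} (ha : 0 ≤ a) :
    volume (slab m a) = ENNReal.ofReal (a * (1 / (m + 1)) ^ (m + 1)) := by
  rw [slab, volume_openBox, Fin.prod_univ_succ]
  simp only [Fin.cons_zero, Fin.cons_succ, sub_zero, Finset.prod_const, Finset.card_univ,
    Fintype.card_fin]
  rw [← ENNReal.ofReal_pow (by positivity), ← ENNReal.ofReal_mul (by positivity)]
  congr 1
  ring

lemma slab_subset_ball (m : ℕ) (hm : 1 ≤ m) {a : ℝ} (ha : a ≤ 1) :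
    slab m a ⊆ ball (0 : Spc (m + 1)) 1 := by
  intro x hx
  have hm' : (1 : ℝ) ≤ m := by exact_mod_cast hm
  have hle : ∀ i, x i ^ 2 ≤ (1 / ((m : ℝ) + 1)) ^ 2 := by
    intro i
    have h := hx i
    refine pow_le_pow_left₀ h.1.le (h.2.le.trans ?_) 2
    refine Fin.cases ?_ (fun j => ?_) i
    · simp only [Fin.cons_zero]; gcongr
    · simp
  rw [mem_ball_zero_iff, EuclideanSpace.norm_eq, Real.sqrt_lt' one_pos]
  simp only [Real.norm_eq_abs, sq_abs]
  calc ∑ i, x i ^ 2 ≤ ∑ _i : Fin (m + 1), (1 / ((m : ℝ) + 1)) ^ 2 :=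
        Finset.sum_le_sum fun i _ => hle i
    _ = 1 / ((m : ℝ) + 1) := by
        simp only [Finset.sum_const, Finset.card_univ, Fintype.card_fin, nsmul_eq_mul]
        push_cast
        field_simp
    _ < 1 ^ 2 := by
        rw [one_pow, div_lt_one (by positivity)]; linarith

lemma volume_slab_inter_ball_le (m : ℕ) {a ρ : ℝ} (ha : 0 ≤ a) (hρ : 0 < ρ) (x : Spc (m + 1)) :
    volume (slab m a ∩ ball x ρ) ≤ ENNReal.ofReal (a * (2 * ρ) ^ m) := by
  have hsub : slab m a ∩ ball x ρ ⊆
      openBox (Fin.cons 0 fun i => x (Fin.succ i) - ρ) (Fin.cons a fun i => x (Fin.succ i) + ρ) := by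
    rintro y ⟨hy, hyx⟩ i
    refine Fin.cases ?_ (fun j => ?_) i
    · have h := hy 0
      simp only [Fin.cons_zero, mem_Ioo] at h ⊢
      refine ⟨h.1, h.2.trans_le (div_le_self ha ?_)⟩
      have : (0 : ℝ) ≤ m := m.cast_nonneg
      linarith
    · have h := (PiLp.norm_apply_le (y - x) j.succ).trans_lt (mem_ball_iff_norm.1 hyx)
      rw [PiLp.sub_apply, Real.norm_eq_abs, abs_lt] at h
      simp only [Fin.cons_succ, mem_Ioo]
      constructor <;> linarith
  refine (measure_mono hsub).trans_eq ?_
  rw [volume_openBox, Fin.prod_univ_succ, ENNReal.ofReal_mul ha, ENNReal.ofReal_pow (by positivity)]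
  simp only [Fin.cons_zero, Fin.cons_succ, sub_zero]
  simp only [add_sub_sub_cancel, Finset.prod_const, Finset.card_univ, Fintype.card_fin, two_mul]

/-- The height of the `n`-th layer: times the width `exp (-(n + 1))` it is `1 / (n + 1) ^ 2`. -/
def layerHeight (n : ℕ) : ℝ := Real.exp (n + 1) / ((n : ℝ) + 1) ^ 2

lemma layerHeight_nonneg (n : ℕ) : 0 ≤ layerHeight n := by unfold layerHeight; positivity

lemma layerHeight_mul_exp (n : ℕ) :
    layerHeight n * Real.exp (-((n : ℝ) + 1)) = 1 / ((n : ℝ) + 1) ^ 2 := by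
  rw [layerHeight, Real.exp_neg]
  field_simp

lemma tendsto_layerHeight_rpow_mul_exp {s : ℝ} (hs : 1 < s) :
    Tendsto (fun n : ℕ => layerHeight n ^ s * Real.exp (-((n : ℝ) + 1))) atTop atTop := by
  have h := (tendsto_exp_mul_div_rpow_atTop (2 * s) (s - 1) (by linarith)).comp
    (tendsto_atTop_add_const_right atTop (1 : ℝ) tendsto_natCast_atTop_atTop)
  refine h.congr fun n => ?_
  have hn : (0 : ℝ) < n + 1 := by positivity
  simp only [Function.comp_apply, layerHeight]
  rw [Real.div_rpow (by positivity) (by positivity), ← Real.exp_mul, ← Real.rpow_natCast,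
    ← Real.rpow_mul hn.le, div_mul_eq_mul_div, ← Real.exp_add]
  congr 2
  ring

/-- A superposition of slabs of width `exp (-(n + 1))`: it is integrable, but none of its powers
with exponent above one is. -/
def layerSum (m : ℕ) (x : Spc (m + 1)) : ℝ≥0∞ :=
  ∑' n : ℕ, (slab m (Real.exp (-((n : ℝ) + 1)))).indicator
    (fun _ => ENNReal.ofReal (layerHeight n)) x

lemma measurable_layerSum (m : ℕ) : Measurable (layerSum m) :=
  Measurable.tsum fun _ => measurable_const.indicator (measurableSet_slab m _)

lemma setLIntegral_layerSum_le (m : ℕ) (A : Set (Spc (m + 1))) (K : ℝ)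
    (hA : ∀ a : ℝ, 0 ≤ a → volume (slab m a ∩ A) ≤ ENNReal.ofReal (a * K)) :
    ∫⁻ x in A, layerSum m x ≤
      (∑' n : ℕ, ENNReal.ofReal (1 / ((n : ℝ) + 1) ^ 2)) * ENNReal.ofReal K := by
  simp only [layerSum]
  rw [lintegral_tsum fun n =>
    (measurable_const.indicator (measurableSet_slab m _)).aemeasurable, ← ENNReal.tsum_mul_right]
  refine ENNReal.tsum_le_tsum fun n => ?_
  rw [lintegral_indicator_const (measurableSet_slab m _),
    Measure.restrict_apply (measurableSet_slab m _)]
  refine (mul_le_mul_right (hA _ (Real.exp_pos _).le) _).trans_eq ?_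
  rw [← ENNReal.ofReal_mul (layerHeight_nonneg n), ← mul_assoc, layerHeight_mul_exp,
    ENNReal.ofReal_mul (by positivity)]

lemma tsum_ofReal_one_div_add_one_sq_ne_top :
    ∑' n : ℕ, ENNReal.ofReal (1 / ((n : ℝ) + 1) ^ 2) ≠ ⊤ := by
  have h := (_root_.summable_nat_add_iff 1).2 (Real.summable_one_div_nat_pow.2 one_lt_two)
  push_cast at h
  exact h.tsum_ofReal_ne_top

lemma lintegral_layerSum_ne_top (m : ℕ) : ∫⁻ x, layerSum m x ≠ ⊤ := by
  have h := setLIntegral_layerSum_le m univ ((1 / (m + 1)) ^ (m + 1)) fun a ha => by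
    rw [inter_univ, volume_slab m ha]
  rw [setLIntegral_univ] at h
  exact ne_top_of_le_ne_top
    (ENNReal.mul_ne_top tsum_ofReal_one_div_add_one_sq_ne_top ENNReal.ofReal_ne_top) h

lemma setLIntegral_ball_layerSum_le (m : ℕ) {ρ : ℝ} (hρ : 0 < ρ) (x : Spc (m + 1)) :
    ∫⁻ y in ball x ρ, layerSum m y ≤
      (∑' n : ℕ, ENNReal.ofReal (1 / ((n : ℝ) + 1) ^ 2)) * ENNReal.ofReal ((2 * ρ) ^ m) :=
  setLIntegral_layerSum_le m _ _ fun _ ha => volume_slab_inter_ball_le m ha hρ x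

lemma setLIntegral_ball_layerSum_rpow (m : ℕ) (hm : 1 ≤ m) {s : ℝ} (hs : 1 < s) :
    ∫⁻ y in ball (0 : Spc (m + 1)) 1, layerSum m y ^ s = ⊤ := by
  have hK : (0 : ℝ) < (1 / ((m : ℝ) + 1)) ^ (m + 1) := by positivity
  have hlim := ENNReal.tendsto_ofReal_atTop.comp
    ((tendsto_layerHeight_rpow_mul_exp hs).atTop_mul_const hK)
  refine top_le_iff.1 (le_of_tendsto' hlim fun n => ?_)
  have ha : Real.exp (-((n : ℝ) + 1)) ≤ 1 :=
    Real.exp_le_one_iff.2 (by linarith [n.cast_nonneg (α := ℝ)])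
  calc ENNReal.ofReal
        (layerHeight n ^ s * Real.exp (-((n : ℝ) + 1)) * (1 / ((m : ℝ) + 1)) ^ (m + 1))
      = ∫⁻ _ in slab m (Real.exp (-((n : ℝ) + 1))), ENNReal.ofReal (layerHeight n) ^ s := by
        rw [setLIntegral_const, volume_slab m (Real.exp_pos _).le,
          ENNReal.ofReal_rpow_of_nonneg (layerHeight_nonneg n) (by linarith),
          ← ENNReal.ofReal_mul (Real.rpow_nonneg (layerHeight_nonneg n) s), mul_assoc]
    _ ≤ ∫⁻ y in slab m (Real.exp (-((n : ℝ) + 1))), layerSum m y ^ s := by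
        refine setLIntegral_mono' (measurableSet_slab m _) fun y hy => ?_
        refine ENNReal.rpow_le_rpow ?_ (by linarith)
        refine le_trans (le_of_eq ?_) (ENNReal.le_tsum n)
        rw [indicator_of_mem hy]
    _ ≤ _ := lintegral_mono_set (slab_subset_ball m hm ha)

/-- Example 9.25.1: for `d ≥ 2` and `p ∈ [d-1, d)` there is a
    nonnegative `b ∈ L_p(ℝ^d)` with `∫_B b^p ≤ N ρ^{d-p}` for every ball of
    radius `ρ ≤ 1`, but `∫_{B_1(0)} b^q = ∞` for every `q > p`. -/
theorem statement16 (d : ℕ) (hd : 2 ≤ d) (p : ℝ)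
    (hp1 : (d : ℝ) - 1 ≤ p) (hp2 : p < d) :
    ∃ b : Spc d → ℝ, Measurable b ∧ (∀ x, 0 ≤ b x) ∧
      (∫⁻ x : Spc d, ENNReal.ofReal (b x) ^ p) ≠ ⊤ ∧
      (∃ N : ℝ≥0, ∀ ρ : ℝ, 0 < ρ → ρ ≤ 1 → ∀ x : Spc d,
        (∫⁻ y in Metric.ball x ρ, ENNReal.ofReal (b y) ^ p) ≤
          N * ENNReal.ofReal (ρ ^ ((d : ℝ) - p))) ∧
      (∀ q : ℝ, p < q →
        (∫⁻ y in Metric.ball (0 : Spc d) 1, ENNReal.ofReal (b y) ^ q) = ⊤) := by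
  obtain ⟨m, rfl⟩ : ∃ m, d = m + 1 := ⟨d - 1, by omega⟩
  have hm : 1 ≤ m := by omega
  have hm' : (1 : ℝ) ≤ m := by exact_mod_cast hm
  push_cast at hp1 hp2
  have hp : 0 < p := by linarith
  have hrpow : ∀ (r : ℝ), 0 ≤ r → ∀ x : Spc (m + 1),
      ENNReal.ofReal ((layerSum m x).toReal ^ (1 / p)) ^ r =
        ENNReal.ofReal (layerSum m x).toReal ^ (r / p) := fun r _ x => by
    rw [← ENNReal.ofReal_rpow_of_nonneg ENNReal.toReal_nonneg (by positivity),
      ← ENNReal.rpow_mul, one_div_mul_eq_div]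
  have hle : ∀ x : Spc (m + 1),
      ENNReal.ofReal ((layerSum m x).toReal ^ (1 / p)) ^ p ≤ layerSum m x := fun x => by
    rw [hrpow p hp.le, div_self hp.ne', ENNReal.rpow_one]
    exact ENNReal.ofReal_toReal_le
  refine ⟨fun x => (layerSum m x).toReal ^ (1 / p),
    (measurable_layerSum m).ennreal_toReal.pow_const _,
    fun x => Real.rpow_nonneg ENNReal.toReal_nonneg _,
    ne_top_of_le_ne_top (lintegral_layerSum_ne_top m) (lintegral_mono hle),
    ⟨(∑' n : ℕ, ENNReal.ofReal (1 / ((n : ℝ) + 1) ^ 2)).toNNReal * 2 ^ m,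
      fun ρ hρ hρ1 x => ?_⟩, fun q hq => ?_⟩
  · refine (lintegral_mono hle).trans ((setLIntegral_ball_layerSum_le m hρ x).trans ?_)
    rw [ENNReal.coe_mul, ENNReal.coe_toNNReal tsum_ofReal_one_div_add_one_sq_ne_top, mul_assoc,
      mul_pow, ENNReal.ofReal_mul (by positivity), ENNReal.ofReal_pow zero_le_two]
    push_cast
    rw [ENNReal.ofReal_ofNat]
    gcongr
    rw [← Real.rpow_natCast]
    exact Real.rpow_le_rpow_of_exponent_ge hρ hρ1 (by linarith)
  · rw [← setLIntegral_ball_layerSum_rpow m hm ((one_lt_div hp).2 hq)]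
    refine lintegral_congr_ae (ae_restrict_of_ae ?_)
    filter_upwards [ae_lt_top (measurable_layerSum m) (lintegral_layerSum_ne_top m)] with x hx
    rw [hrpow q (hp.trans hq).le, ENNReal.ofReal_toReal hx.ne]
end
end

section
/- Let d = d' + d'' with d' ≥ 2, d'' ≥ 1 (so d ≥ 3), write x = (x', x'') ∈ ℝ^{d'} × ℝ^{d''}, and define b(x) := 1/|x'| (for x' ≠ 0). Then for every p ∈ [1, d'): sup { ρ·(⨍_{B_ρ(x)} b^p dy)^{1/p} : 0 < ρ ≤ 1, x ∈ ℝ^d } < ∞; but b ∉ L_{d',loc}(ℝ^d), i.e. ∫_{B_1(0)} |x'|^{−d'} dx = ∞. -/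
open MeasureTheory ENNReal NNReal Metric Set Filter Topology

noncomputable section

/-- The function `b(x) = 1/|x'|` on `ℝ^d = ℝ^{d'} × ℝ^{d''}`, where `x'`
    consists of the first `d'` coordinates. -/
def bSing (d' d'' : ℕ) (y : Spc (d' + d'')) : ℝ :=
  (Real.sqrt (∑ i : Fin d', (y (Fin.castAdd d'' i)) ^ 2))⁻¹

/-- The splitting `ℝ^{m+n} → ℝ^m × ℝ^n`, `x ↦ (x', x'')`. -/
def splitCoords (m n : ℕ) (y : Spc (m + n)) : Spc m × Spc n :=
  (WithLp.toLp 2 fun i => y (Fin.castAdd n i), WithLp.toLp 2 fun j => y (Fin.natAdd m j))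

theorem measurePreserving_splitCoords (m n : ℕ) :
    MeasurePreserving (splitCoords m n) volume volume := by
  have h1 := PiLp.volume_preserving_ofLp (Fin (m + n))
  have h2 := (volume_measurePreserving_piCongrLeft (fun _ : Fin (m + n) => ℝ)
    (finSumFinEquiv (m := m) (n := n))).symm
  have h3 := volume_measurePreserving_sumPiEquivProdPi (fun _ : Fin m ⊕ Fin n => ℝ)
  have h4 := (PiLp.volume_preserving_toLp (Fin m)).prod (PiLp.volume_preserving_toLp (Fin n))
  exact h4.comp (h3.comp (h2.comp h1))

theorem bSing_eq_inv_norm_fst (m n : ℕ) (y : Spc (m + n)) :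
    bSing m n y = ‖(splitCoords m n y).1‖⁻¹ := by
  simp [bSing, splitCoords, EuclideanSpace.norm_eq]

theorem norm_sq_splitCoords (m n : ℕ) (y : Spc (m + n)) :
    ‖(splitCoords m n y).1‖ ^ 2 + ‖(splitCoords m n y).2‖ ^ 2 = ‖y‖ ^ 2 := by
  simp [splitCoords, EuclideanSpace.norm_sq_eq, Fin.sum_univ_add]

theorem splitCoords_sub (m n : ℕ) (x y : Spc (m + n)) :
    splitCoords m n (x - y) = splitCoords m n x - splitCoords m n y := rfl

theorem ball_subset_preimage_splitCoords (m n : ℕ) (x : Spc (m + n)) (ρ : ℝ) :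
    ball x ρ ⊆ splitCoords m n ⁻¹'
      (ball (splitCoords m n x).1 ρ ×ˢ ball (splitCoords m n x).2 ρ) := by
  intro y hy
  have h := norm_sq_splitCoords m n (y - x)
  rw [mem_ball, dist_eq_norm] at hy
  rw [splitCoords_sub] at h
  simp only [mem_preimage, mem_prod, mem_ball, dist_eq_norm]
  simp only [Prod.fst_sub, Prod.snd_sub] at h
  have h0 := norm_nonneg (y - x)
  constructor <;> refine lt_of_le_of_lt ?_ hy <;> refine abs_le_of_sq_le_sq' ?_ h0 |>.2 <;> nlinarith

theorem preimage_splitCoords_subset_ball (m n : ℕ) :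
    splitCoords m n ⁻¹' (ball 0 (1 / 2) ×ˢ ball 0 (1 / 2)) ⊆ ball 0 1 := by
  intro y hy
  have h := norm_sq_splitCoords m n y
  simp only [mem_preimage, mem_prod, mem_ball_zero_iff] at hy ⊢
  nlinarith [norm_nonneg (splitCoords m n y).1, norm_nonneg (splitCoords m n y).2, norm_nonneg y]

theorem setLIntegral_splitCoords (m n : ℕ) (f : Spc m → ℝ≥0∞) (hf : Measurable f)
    {s : Set (Spc m)} {t : Set (Spc n)} (hs : MeasurableSet s) (ht : MeasurableSet t) :
    ∫⁻ y in splitCoords m n ⁻¹' (s ×ˢ t), f (splitCoords m n y).1 =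
      (∫⁻ u in s, f u) * volume t := by
  rw [(measurePreserving_splitCoords m n).setLIntegral_comp_preimage (hs.prod ht)
    (f := fun z => f z.1) (by fun_prop), Measure.volume_eq_prod, ← Measure.prod_restrict]
  simpa using lintegral_prod_mul (μ := volume.restrict s) (ν := volume.restrict t)
    (f := f) (g := fun _ => 1) hf.aemeasurable aemeasurable_const

section Radial

variable {E : Type*} [NormedAddCommGroup E] [NormedSpace ℝ E] [FiniteDimensional ℝ E]
  [MeasurableSpace E] [BorelSpace E] (μ : Measure E) [μ.IsAddHaarMeasure]

theorem setLIntegral_ball_inv_norm_rpow_lt_top_iff [Nontrivial E] {p r : ℝ} (hp : 0 ≤ p)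
    (hr : 0 < r) :
    ∫⁻ y in ball (0 : E) r, ENNReal.ofReal ‖y‖⁻¹ ^ p ∂μ < ⊤ ↔ p < Module.finrank ℝ E := by
  have key := integrableOn_fun_norm_addHaar μ (f := fun t : ℝ => t⁻¹ ^ p) (r := r)
  have hd : 0 < Module.finrank ℝ E := Module.finrank_pos
  have h1 : IntegrableOn (fun y : ℝ => y ^ (Module.finrank ℝ E - 1) • y⁻¹ ^ p) (Ioo 0 r) ↔
      p < Module.finrank ℝ E := by
    rw [integrableOn_congr_fun (g := fun y : ℝ => y ^ ((Module.finrank ℝ E : ℝ) - 1 - p)) _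
      measurableSet_Ioo, intervalIntegral.integrableOn_Ioo_rpow_iff hr]
    · constructor <;> intro h <;> linarith
    · intro y hy
      have hy0 : 0 < y := hy.1
      simp only [smul_eq_mul]
      rw [Real.rpow_sub hy0, Real.inv_rpow hy0.le, ← Real.rpow_natCast, Nat.cast_sub hd,
        div_eq_mul_inv, Nat.cast_one]
  rw [← h1, ← key, IntegrableOn, ← lintegral_ofReal_ne_top_iff_integrable, lt_top_iff_ne_top]
  · simp_rw [ENNReal.ofReal_rpow_of_nonneg (inv_nonneg.2 (norm_nonneg _)) hp]
  · exact Measurable.aestronglyMeasurable (by fun_prop)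
  · exact .of_forall fun y => by positivity

theorem setLIntegral_ball_zero_inv_norm_rpow {p ρ : ℝ} (hp : 0 ≤ p) (hρ : 0 < ρ) :
    ∫⁻ y in ball (0 : E) ρ, ENNReal.ofReal ‖y‖⁻¹ ^ p ∂μ =
      ENNReal.ofReal (ρ ^ Module.finrank ℝ E) *
        (ENNReal.ofReal ρ⁻¹ ^ p * ∫⁻ y in ball (0 : E) 1, ENNReal.ofReal ‖y‖⁻¹ ^ p ∂μ) := by
  have hmeas : Measurable fun y : E => ENNReal.ofReal ‖y‖⁻¹ ^ p := by fun_prop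
  have hpre : (fun y : E => ρ • y) ⁻¹' ball 0 ρ = ball 0 1 := by
    ext y
    simp [norm_smul, abs_of_pos hρ, hρ]
  have hmap : μ = ENNReal.ofReal (ρ ^ Module.finrank ℝ E) • Measure.map (ρ • ·) μ := by
    rw [Measure.map_addHaar_smul μ hρ.ne', smul_smul, ← ENNReal.ofReal_mul (by positivity),
      abs_of_pos (by positivity), mul_inv_cancel₀ (by positivity), ENNReal.ofReal_one, one_smul]
  conv_lhs => rw [hmap]
  rw [Measure.restrict_smul, lintegral_smul_measure, smul_eq_mul,
    setLIntegral_map measurableSet_ball hmeas (by fun_prop), hpre,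
    ← lintegral_const_mul _ hmeas]
  congr 1
  refine lintegral_congr fun y => ?_
  rw [norm_smul, mul_inv, Real.norm_of_nonneg hρ.le, ENNReal.ofReal_mul (by positivity),
    ENNReal.mul_rpow_of_nonneg _ _ hp]

theorem setLIntegral_ball_inv_norm_rpow_le {p ρ : ℝ} (hp : 0 ≤ p) (hρ : 0 < ρ) (x : E) :
    ∫⁻ y in ball x ρ, ENNReal.ofReal ‖y‖⁻¹ ^ p ∂μ ≤
      ENNReal.ofReal (ρ ^ Module.finrank ℝ E) * (ENNReal.ofReal ρ⁻¹ ^ p *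
        (∫⁻ y in ball (0 : E) 1, ENNReal.ofReal ‖y‖⁻¹ ^ p ∂μ + μ (ball 0 1))) := by
  calc ∫⁻ y in ball x ρ, ENNReal.ofReal ‖y‖⁻¹ ^ p ∂μ
      ≤ ∫⁻ y in ball 0 ρ ∪ (ball x ρ \ ball 0 ρ), ENNReal.ofReal ‖y‖⁻¹ ^ p ∂μ :=
        lintegral_mono_set (by simp)
    _ ≤ ∫⁻ y in ball 0 ρ, ENNReal.ofReal ‖y‖⁻¹ ^ p ∂μ +
          ∫⁻ y in ball x ρ \ ball 0 ρ, ENNReal.ofReal ‖y‖⁻¹ ^ p ∂μ := lintegral_union_le _ _ _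
    _ ≤ ∫⁻ y in ball 0 ρ, ENNReal.ofReal ‖y‖⁻¹ ^ p ∂μ +
          ENNReal.ofReal ρ⁻¹ ^ p * μ (ball x ρ) := by
        gcongr
        calc _ ≤ ∫⁻ y in ball x ρ \ ball 0 ρ, ENNReal.ofReal ρ⁻¹ ^ p ∂μ := by
              refine setLIntegral_mono' (measurableSet_ball.diff measurableSet_ball) fun y hy => ?_
              have : ρ ≤ ‖y‖ := by simpa using hy.2
              gcongr
          _ ≤ _ := by
              rw [setLIntegral_const]
              gcongr
              exact sdiff_subset
    _ = _ := by
        rw [setLIntegral_ball_zero_inv_norm_rpow μ hp hρ, Measure.addHaar_ball_of_pos μ x hρ]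
        ring

end Radial

/-- Example 7,29.1: for `d = d' + d''` with `d' ≥ 2`, the
    function `b(x) = 1/|x'|` satisfies the Morrey condition
    `sup_{ρ ≤ 1, x} ρ (⨍_{B_ρ(x)} b^p)^{1/p} < ∞` for every `p ∈ [1, d')`,
    but `b ∉ L_{d',loc}`: `∫_{B_1(0)} |x'|^{-d'} dx = ∞`. -/
theorem statement17 (d' d'' : ℕ) (hd' : 2 ≤ d') (hd'' : 1 ≤ d'') :
    (∀ p : ℝ, 1 ≤ p → p < d' →
      ∃ M : ℝ≥0, ∀ ρ : ℝ, 0 < ρ → ρ ≤ 1 → ∀ x : Spc (d' + d''),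
        ENNReal.ofReal ρ *
            ((∫⁻ y in Metric.ball x ρ, ENNReal.ofReal (bSing d' d'' y) ^ p) /
                volume (Metric.ball x ρ)) ^ (1 / p) ≤ M) ∧
    (∫⁻ y in Metric.ball (0 : Spc (d' + d'')) 1,
        ENNReal.ofReal (bSing d' d'' y) ^ (d' : ℝ)) = ⊤ := by
  have : Nonempty (Fin d') := ⟨⟨0, by lia⟩⟩
  simp_rw [bSing_eq_inv_norm_fst]
  refine ⟨fun p hp hpd => ?_, ?_⟩
  · have hp0 : 0 < p := by linarith
    set I := ∫⁻ u in ball (0 : Spc d') 1, ENNReal.ofReal ‖u‖⁻¹ ^ p with hI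
    have hI_top : I < ⊤ :=
      (setLIntegral_ball_inv_norm_rpow_lt_top_iff volume hp0.le one_pos).2 (by simpa using hpd)
    set V := volume (ball (0 : Spc d') 1) with hV
    set W := volume (ball (0 : Spc d'') 1) with hW
    set U := volume (ball (0 : Spc (d' + d'')) 1) with hU
    have hU0 : U ≠ 0 := (measure_ball_pos _ _ one_pos).ne'
    have hC : ((I + V) * W / U) ^ (1 / p) ≠ ⊤ := by
      refine (ENNReal.rpow_lt_top_of_nonneg (by positivity) ?_).ne
      refine ENNReal.div_ne_top (ENNReal.mul_ne_top ?_ measure_ball_lt_top.ne) hU0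
      exact ENNReal.add_ne_top.2 ⟨hI_top.ne, measure_ball_lt_top.ne⟩
    refine ⟨(((I + V) * W / U) ^ (1 / p)).toNNReal, fun ρ hρ _ x => ?_⟩
    rw [ENNReal.coe_toNNReal hC]
    have hmean : (∫⁻ y in ball x ρ, ENNReal.ofReal ‖(splitCoords d' d'' y).1‖⁻¹ ^ p) /
        volume (ball x ρ) ≤ ENNReal.ofReal ρ⁻¹ ^ p * ((I + V) * W / U) := by
      have hρd : ENNReal.ofReal (ρ ^ (d' + d'')) ≠ 0 := by simp; positivity
      calc _ ≤ (ENNReal.ofReal (ρ ^ d') * (ENNReal.ofReal ρ⁻¹ ^ p * (I + V)) *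
            (ENNReal.ofReal (ρ ^ d'') * W)) / (ENNReal.ofReal (ρ ^ (d' + d'')) * U) := by
            rw [Measure.addHaar_ball_of_pos volume x hρ, finrank_euclideanSpace_fin]
            gcongr
            refine (lintegral_mono_set (ball_subset_preimage_splitCoords d' d'' x ρ)).trans ?_
            rw [setLIntegral_splitCoords d' d'' (fun u => ENNReal.ofReal ‖u‖⁻¹ ^ p)
              (by fun_prop) measurableSet_ball measurableSet_ball,
              Measure.addHaar_ball_of_pos volume (splitCoords d' d'' x).2 hρ,
              finrank_euclideanSpace_fin]
            gcongr
            simpa using setLIntegral_ball_inv_norm_rpow_le volume hp0.le hρ (splitCoords d' d'' x).1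
        _ = (ENNReal.ofReal (ρ ^ (d' + d'')) * (ENNReal.ofReal ρ⁻¹ ^ p * ((I + V) * W))) /
              (ENNReal.ofReal (ρ ^ (d' + d'')) * U) := by
            rw [pow_add, ENNReal.ofReal_mul (by positivity)]
            congr 1
            ring
        _ = _ := by
            rw [ENNReal.mul_div_mul_left _ _ hρd ENNReal.ofReal_ne_top, mul_div_assoc]
    calc _ ≤ ENNReal.ofReal ρ * (ENNReal.ofReal ρ⁻¹ ^ p * ((I + V) * W / U)) ^ (1 / p) := by
          gcongr
      _ = _ := by
          rw [ENNReal.mul_rpow_of_nonneg _ _ (by positivity), ← ENNReal.rpow_mul,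
            mul_one_div_cancel hp0.ne', ENNReal.rpow_one, ← mul_assoc,
            ← ENNReal.ofReal_mul hρ.le, mul_inv_cancel₀ hρ.ne', ENNReal.ofReal_one, one_mul]
  · refine eq_top_mono (lintegral_mono_set (preimage_splitCoords_subset_ball d' d'')) ?_
    rw [setLIntegral_splitCoords d' d'' (fun u => ENNReal.ofReal ‖u‖⁻¹ ^ (d' : ℝ))
      (by fun_prop) measurableSet_ball measurableSet_ball]
    have h := setLIntegral_ball_inv_norm_rpow_lt_top_iff (E := Spc d') volume
      (p := d') (r := 1 / 2) (by positivity) (by norm_num)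
    rw [finrank_euclideanSpace_fin, lt_self_iff_false, iff_false, not_lt_top_iff] at h
    rw [h, ENNReal.top_mul (measure_ball_pos _ _ (by norm_num)).ne']
end
end
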